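/- There do not exist an open interval I ⊆ ℝ, smooth functions x, y, r, c : I → ℝ with r > 0 on I, constants A₀, B₀ ∈ ℝ with (A₀, B₀) ≠ (0, 0), and a point τ₀ ∈ I with c(τ₀) ≠ 0, such that on I: x'' = A₀·r², y'' = B₀·r², r'' = r + c·r², c'' = c, and x'² + y'² + r'² = r². -/

import Mathlib

open Set

lemma zero_deriv_aux {U : Set ℝ} (hU : IsOpen U) {f : ℝ → ℝ} {f' t : ℝ}
    (h : ∀ s ∈ U, f s = 0) (ht : t ∈ U) (hf : HasDerivAt f f' t) : f' = 0 := by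
  have h1 : f =ᶠ[nhds t] fun _ => (0 : ℝ) := by
    filter_upwards [hU.mem_nhds ht] with s hs using h s hs
  exact hf.unique ((hasDerivAt_const t (0 : ℝ)).congr_of_eventuallyEq h1)

lemma core_aux {U : Set ℝ} (hU : IsOpen U) {X Y r p c q : ℝ → ℝ} {A B : ℝ}
    (hAB : 0 < A ^ 2 + B ^ 2)
    (hX : ∀ t ∈ U, HasDerivAt X (A * r t ^ 2) t)
    (hY : ∀ t ∈ U, HasDerivAt Y (B * r t ^ 2) t)
    (hr : ∀ t ∈ U, HasDerivAt r (p t) t)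
    (hp : ∀ t ∈ U, HasDerivAt p (r t + c t * r t ^ 2) t)
    (hc : ∀ t ∈ U, HasDerivAt c (q t) t)
    (hq : ∀ t ∈ U, HasDerivAt q (c t) t)
    (r0 : ∀ t ∈ U, 0 < r t) (c0 : ∀ t ∈ U, c t ≠ 0) (q0 : ∀ t ∈ U, q t ≠ 0)
    (hE : ∀ t ∈ U, X t ^ 2 + Y t ^ 2 + p t ^ 2 - r t ^ 2 = 0)
    {t : ℝ} (ht : t ∈ U) : False := by
  have e0 : ∀ t ∈ U, A * X t + B * Y t + c t * p t = 0 := by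
    intro t ht
    have h := zero_deriv_aux hU hE ht (((((hX t ht).fun_pow 2).fun_add ((hY t ht).fun_pow 2)).fun_add
      ((hp t ht).fun_pow 2)).fun_sub ((hr t ht).fun_pow 2))
    have hr2 : 2 * r t ^ 2 ≠ 0 := by have := r0 t ht; positivity
    apply mul_left_cancel₀ hr2
    push_cast at h
    linear_combination h
  have e1 : ∀ t ∈ U, (A ^ 2 + B ^ 2 + c t ^ 2) * r t ^ 2 + q t * p t + c t * r t = 0 := by
    intro t ht
    have h := zero_deriv_aux hU e0 ht ((((hX t ht).const_mul A).fun_add ((hY t ht).const_mul B)).fun_add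
      ((hc t ht).fun_mul (hp t ht)))
    linear_combination h
  have e3 : ∀ t ∈ U, 3 * (c t * r t ^ 3) + 2 * r t ^ 2 - 2 * p t ^ 2 = 0 := by
    intro t ht
    have h := zero_deriv_aux hU e1 ht
      ((((((hc t ht).fun_pow 2).const_add (A ^ 2 + B ^ 2)).fun_mul ((hr t ht).fun_pow 2)).fun_add
      ((hq t ht).fun_mul (hp t ht))).fun_add ((hc t ht).fun_mul (hr t ht)))
    apply mul_left_cancel₀ (q0 t ht)
    push_cast at h
    linear_combination r t * h - 2 * p t * e1 t ht
  have e4 : ∀ t ∈ U, 5 * c t * p t + 3 * q t * r t = 0 := by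
    intro t ht
    have h := zero_deriv_aux hU e3 ht
      (((((hc t ht).fun_mul ((hr t ht).fun_pow 3)).const_mul 3).fun_add
      (((hr t ht).fun_pow 2).const_mul 2)).fun_sub (((hp t ht).fun_pow 2).const_mul 2))
    have hr2 : r t ^ 2 ≠ 0 := by have := r0 t ht; positivity
    apply mul_left_cancel₀ hr2
    push_cast at h
    linear_combination h
  have e5 : ∀ t ∈ U, 5 * c t * (A ^ 2 + B ^ 2 + c t ^ 2) * r t - 3 * q t ^ 2 + 5 * c t ^ 2 = 0 := by
    intro t ht
    apply mul_left_cancel₀ (r0 t ht).ne'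
    linear_combination 5 * c t * e1 t ht - q t * e4 t ht
  have e6 : ∀ t ∈ U, 75 * c t ^ 3 * r t + 50 * c t ^ 2 - 18 * q t ^ 2 = 0 := by
    intro t ht
    have hr2 : r t ^ 2 ≠ 0 := by have := r0 t ht; positivity
    apply mul_left_cancel₀ hr2
    linear_combination 25 * c t ^ 2 * e3 t ht + 2 * (5 * c t * p t - 3 * q t * r t) * e4 t ht
  have e7 : ∀ t ∈ U, 2 * c t ^ 4 + 27 * (q t ^ 2 * c t ^ 2) - 27 * c t ^ 4
      + 32 * (A ^ 2 + B ^ 2) * c t ^ 2 - 18 * (A ^ 2 + B ^ 2) * (q t ^ 2 - c t ^ 2) = 0 := by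
    intro t ht
    linear_combination (A ^ 2 + B ^ 2 + c t ^ 2) * e6 t ht - 15 * c t ^ 2 * e5 t ht
  have e8 : ∀ t ∈ U, 27 * q t ^ 2 - 23 * c t ^ 2 + 32 * (A ^ 2 + B ^ 2) = 0 := by
    intro t ht
    have h := zero_deriv_aux hU e7 ht
      (((((((hc t ht).fun_pow 4).const_mul 2).fun_add
      ((((hq t ht).fun_pow 2).fun_mul ((hc t ht).fun_pow 2)).const_mul 27)).fun_sub
      (((hc t ht).fun_pow 4).const_mul 27)).fun_add
      (((hc t ht).fun_pow 2).const_mul (32 * (A ^ 2 + B ^ 2)))).fun_sub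
      ((((hq t ht).fun_pow 2).fun_sub ((hc t ht).fun_pow 2)).const_mul (18 * (A ^ 2 + B ^ 2))))
    have h2 : 2 * c t * q t ≠ 0 := mul_ne_zero (mul_ne_zero two_ne_zero (c0 t ht)) (q0 t ht)
    apply mul_left_cancel₀ h2
    push_cast at h
    linear_combination h
  have h := zero_deriv_aux hU e8 ht
    (((((hq t ht).fun_pow 2).const_mul 27).fun_sub
      (((hc t ht).fun_pow 2).const_mul 23)).add_const (32 * (A ^ 2 + B ^ 2)))
  push_cast at h
  apply mul_ne_zero (c0 t ht) (q0 t ht)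
  linear_combination h / 8

lemma hasDeriv_aux {lo hi : ℝ} {f : ℝ → ℝ} (h : ContDiffOn ℝ (⊤ : ℕ∞) f (Ioo lo hi)) :
    (∀ t ∈ Ioo lo hi, HasDerivAt f (deriv f t) t) ∧
    (∀ t ∈ Ioo lo hi, HasDerivAt (deriv f) (deriv (deriv f) t) t) := by
  have h2 : ContDiffOn ℝ 2 f (Ioo lo hi) := (contDiffOn_infty.1 h) 2
  have h1 : ContDiffOn ℝ 1 (deriv f) (Ioo lo hi) := h2.deriv_of_isOpen isOpen_Ioo (by norm_num)
  exact ⟨fun t ht => ((h2.differentiableOn (by norm_num)).differentiableAt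
      (isOpen_Ioo.mem_nhds ht)).hasDerivAt,
    fun t ht => ((h1.differentiableOn (by norm_num)).differentiableAt
      (isOpen_Ioo.mem_nhds ht)).hasDerivAt⟩


/-- Exclusion of Case (V): `(a, b)` a nonzero constant vector `(A₀, B₀)` and
`c ≠ 0` at some point is impossible. -/
theorem case_V_cannot_occur :
    ¬ ∃ (lo hi : ℝ) (x y r c : ℝ → ℝ) (A₀ B₀ τ₀ : ℝ),
      ContDiffOn ℝ (⊤ : ℕ∞) x (Ioo lo hi) ∧
      ContDiffOn ℝ (⊤ : ℕ∞) y (Ioo lo hi) ∧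
      ContDiffOn ℝ (⊤ : ℕ∞) r (Ioo lo hi) ∧
      ContDiffOn ℝ (⊤ : ℕ∞) c (Ioo lo hi) ∧
      (∀ τ ∈ Ioo lo hi, 0 < r τ) ∧
      (A₀, B₀) ≠ (0, 0) ∧
      τ₀ ∈ Ioo lo hi ∧ c τ₀ ≠ 0 ∧
      (∀ τ ∈ Ioo lo hi, deriv (deriv x) τ = A₀ * r τ ^ 2) ∧
      (∀ τ ∈ Ioo lo hi, deriv (deriv y) τ = B₀ * r τ ^ 2) ∧
      (∀ τ ∈ Ioo lo hi, deriv (deriv r) τ = r τ + c τ * r τ ^ 2) ∧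
      (∀ τ ∈ Ioo lo hi, deriv (deriv c) τ = c τ) ∧
      (∀ τ ∈ Ioo lo hi,
        deriv x τ ^ 2 + deriv y τ ^ 2 + deriv r τ ^ 2 = r τ ^ 2) := by
  rintro ⟨lo, hi, x, y, r, c, A, B, t0, hx, hy, hr, hc, r0, hAB, ht0, hc0, ex, ey, er, ec, hE⟩
  obtain ⟨-, x2⟩ := hasDeriv_aux hx
  obtain ⟨-, y2⟩ := hasDeriv_aux hy
  obtain ⟨r1, r2⟩ := hasDeriv_aux hr
  obtain ⟨c1, c2⟩ := hasDeriv_aux hc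
  have cc : ContinuousOn c (Ioo lo hi) := fun t ht => (c1 t ht).continuousAt.continuousWithinAt
  have cq : ContinuousOn (deriv c) (Ioo lo hi) :=
    fun t ht => (c2 t ht).continuousAt.continuousWithinAt
  have hne : IsOpen {z : ℝ | z ≠ 0} := isOpen_ne
  have oV := cc.isOpen_inter_preimage isOpen_Ioo hne
  have oW := cq.isOpen_inter_preimage isOpen_Ioo hne
  have hAB' : 0 < A ^ 2 + B ^ 2 := by
    by_contra hn
    have hA : A = 0 := by nlinarith [sq_nonneg A, sq_nonneg B]
    have hB : B = 0 := by nlinarith [sq_nonneg A, sq_nonneg B]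
    exact hAB (by rw [hA, hB])
  obtain ⟨t1, h1, h1c, h1q⟩ : ∃ t ∈ Ioo lo hi, c t ≠ 0 ∧ deriv c t ≠ 0 := by
    by_contra! hn
    have h := zero_deriv_aux oV (f := deriv c) (fun s hs => hn s hs.1 hs.2) ⟨ht0, hc0⟩ (c2 t0 ht0)
    exact hc0 ((ec t0 ht0).symm.trans h)
  refine core_aux (oV.inter oW) (X := deriv x) (Y := deriv y) (r := r) (p := deriv r) (c := c)
    (q := deriv c) hAB' ?_ ?_ ?_ ?_ ?_ ?_ ?_ ?_ ?_ ?_ (t := t1) ⟨⟨h1, h1c⟩, ⟨h1, h1q⟩⟩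
  · exact fun t ht => ex t ht.1.1 ▸ x2 t ht.1.1
  · exact fun t ht => ey t ht.1.1 ▸ y2 t ht.1.1
  · exact fun t ht => r1 t ht.1.1
  · exact fun t ht => er t ht.1.1 ▸ r2 t ht.1.1
  · exact fun t ht => c1 t ht.1.1
  · intro t ht
    have h := c2 t ht.1.1
    rwa [ec t ht.1.1] at h
  · exact fun t ht => r0 t ht.1.1
  · exact fun t ht => ht.1.2
  · exact fun t ht => ht.2.2
  · exact fun t ht => sub_eq_zero.2 (hE t ht.1.1)
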